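/- Let N ≥ 3 be odd, x ∈ Z_N, and let m be the integer with 2^{m−1} < N < 2^m. Let ν_s be the distribution of Z_s = 2^{s−1}b_1 + 2^{s−2}b_2 + ⋯ + b_s mod N, where b_1, …, b_s are i.i.d. block increments. Then with ξ = 1 − (4−√10)/9, for every s ≥ 1: N·∑_{j=0}^{N−1} (ν_s(j) − 1/N)² ≤ 2·( (1 + ξ^{2⌊s/m⌋})^{m−1} − 1 ). -/

import Mathlib

open Finset

/-- The distribution of a block increment `b = ε₁ + ⋯ + ε_M mod N`, where `M` is geometric
(`Pr[M = k] = (1/3)(2/3)^k`) and the `εᵢ` are i.i.d. uniform on `{1, x}`. -/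
noncomputable def blockPMF (N : ℕ) (x : ZMod N) (b : ZMod N) : ℝ :=
  ∑' k : ℕ, (1 / 3 : ℝ) * (1 / 3) ^ k *
    ∑ a ∈ Finset.range (k + 1),
      (k.choose a : ℝ) *
        (if (a : ZMod N) + ((k - a : ℕ) : ZMod N) * x = b then 1 else 0)

/-- `nu N x s j = Pr[Z_s = j]` where `Z_s = 2^{s−1}b₁ + 2^{s−2}b₂ + ⋯ + b_s mod N`
for i.i.d. block increments `b₁, …, b_s`. -/
noncomputable def nu (N : ℕ) [NeZero N] (x : ZMod N) (s : ℕ) (j : ZMod N) : ℝ :=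
  ∑ b : Fin s → ZMod N,
    (∏ i, blockPMF N x (b i)) *
      (if (∑ i : Fin s, (2 : ZMod N) ^ (s - 1 - (i : ℕ)) * b i) = j then 1 else 0)

theorem AddChar.map_finset_sum_eq_prod {A M ι : Type*} [AddCommMonoid A] [CommMonoid M]
    (ψ : AddChar A M) (S : Finset ι) (f : ι → A) : ψ (∑ i ∈ S, f i) = ∏ i ∈ S, ψ (f i) := by
  classical
  induction S using Finset.induction_on with
  | empty => simp
  | insert a S ha ih => rw [sum_insert ha, prod_insert ha, map_add_eq_mul, ih]

/-- The Fourier transform of a block increment, evaluated at the frequency `t`. -/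
theorem sum_blockPMF_mul_stdAddChar (N : ℕ) [NeZero N] (x t : ZMod N) :
    ∑ b : ZMod N, (blockPMF N x b : ℂ) * ZMod.stdAddChar (t * b)
      = (3 - ZMod.stdAddChar t - ZMod.stdAddChar (t * x))⁻¹ := by
  set p : ℕ → ZMod N → ℝ := fun k b => (1 / 3 : ℝ) * (1 / 3) ^ k *
    ∑ a ∈ Finset.range (k + 1), (k.choose a : ℝ) *
      (if (a : ZMod N) + ((k - a : ℕ) : ZMod N) * x = b then 1 else 0) with hp
  have hsummable : ∀ b, Summable fun k => p k b := by
    intro b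
    refine Summable.of_nonneg_of_le (f := fun k => (1 / 3 : ℝ) * (2 / 3) ^ k) ?_ ?_ ?_
    · intro k
      simp only [hp]
      refine mul_nonneg (by positivity) (Finset.sum_nonneg fun a _ => ?_)
      split_ifs <;> simp
    · intro k
      have h1 : ∑ a ∈ Finset.range (k + 1), (k.choose a : ℝ) *
          (if (a : ZMod N) + ((k - a : ℕ) : ZMod N) * x = b then 1 else 0) ≤ 2 ^ k := by
        rw [show (2 : ℝ) ^ k = ∑ a ∈ Finset.range (k + 1), (k.choose a : ℝ) by
          exact_mod_cast (Nat.sum_range_choose k).symm]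
        refine Finset.sum_le_sum fun a _ => ?_
        split_ifs <;> simp
      calc p k b ≤ (1 / 3 : ℝ) * (1 / 3) ^ k * 2 ^ k := by
            simp only [hp]; gcongr
        _ = (1 / 3 : ℝ) * (2 / 3) ^ k := by
            rw [mul_assoc, ← mul_pow]; norm_num
    · exact (summable_geometric_of_lt_one (by norm_num) (by norm_num)).mul_left _
  have hleft : HasSum (fun k => ∑ b : ZMod N, (p k b : ℂ) * ZMod.stdAddChar (t * b))
      (∑ b : ZMod N, (blockPMF N x b : ℂ) * ZMod.stdAddChar (t * b)) :=
    hasSum_sum fun b _ =>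
      (Complex.hasSum_ofReal.mpr (hsummable b).hasSum).mul_right _
  set z : ℂ := ZMod.stdAddChar t with hz
  set w : ℂ := ZMod.stdAddChar (t * x) with hw
  have hterm : ∀ k, ∑ b : ZMod N, (p k b : ℂ) * ZMod.stdAddChar (t * b)
      = (1 / 3) * ((z + w) / 3) ^ k := by
    intro k
    simp only [hp, Complex.ofReal_mul, Complex.ofReal_sum]
    simp_rw [Finset.mul_sum, Finset.sum_mul]
    rw [Finset.sum_comm]
    rw [div_pow (z + w), add_pow, Finset.sum_div, Finset.mul_sum]
    refine Finset.sum_congr rfl fun a _ => ?_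
    rw [Finset.sum_eq_single ((a : ZMod N) + ((k - a : ℕ) : ZMod N) * x)]
    · have hexp : (ZMod.stdAddChar (t * ((a : ZMod N) + ((k - a : ℕ) : ZMod N) * x)) : ℂ)
          = z ^ a * w ^ (k - a) := by
        rw [hz, hw, ← AddChar.map_nsmul_eq_pow, ← AddChar.map_nsmul_eq_pow,
          ← AddChar.map_add_eq_mul]
        congr 1
        simp only [nsmul_eq_mul]
        ring
      rw [hexp]
      push_cast
      simp
      ring
    · intro b _ hb
      simp [Ne.symm hb]
    · simp
  have hnorm : ‖(z + w) / 3‖ < 1 := by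
    rw [norm_div]
    have : ‖z + w‖ ≤ 2 := (norm_add_le _ _).trans (by
      rw [hz, hw, AddChar.norm_apply, AddChar.norm_apply]; norm_num)
    norm_num
    linarith
  have hright := (hasSum_geometric_of_norm_lt_one hnorm).mul_left (1 / 3 : ℂ)
  simp_rw [hterm] at hleft
  rw [hleft.unique hright, one_div, ← mul_inv]
  congr 1
  ring

/-- The squared modulus of the Fourier transform of a block increment. -/
noncomputable def blockSpectrum (N : ℕ) [NeZero N] (x t : ZMod N) : ℝ :=
  ‖(3 - ZMod.stdAddChar t - ZMod.stdAddChar (t * x) : ℂ)⁻¹‖ ^ 2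

theorem blockSpectrum_nonneg (N : ℕ) [NeZero N] (x t : ZMod N) : 0 ≤ blockSpectrum N x t :=
  sq_nonneg _

theorem blockSpectrum_le_sq_inv {N : ℕ} [NeZero N] {x t : ZMod N} {c : ℝ} (hc : 0 < c)
    (h : c ≤ 2 - (ZMod.stdAddChar t : ℂ).re) : blockSpectrum N x t ≤ c⁻¹ ^ 2 := by
  unfold blockSpectrum
  have hw : (ZMod.stdAddChar (t * x) : ℂ).re ≤ 1 :=
    (Complex.re_le_norm _).trans (AddChar.norm_apply _ _).le
  have hre := Complex.re_le_norm (3 - ZMod.stdAddChar t - ZMod.stdAddChar (t * x) : ℂ)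
  simp only [Complex.sub_re, Complex.re_ofNat] at hre
  rw [norm_inv]
  gcongr
  linarith

theorem blockSpectrum_le_one (N : ℕ) [NeZero N] (x t : ZMod N) : blockSpectrum N x t ≤ 1 := by
  have hz : (ZMod.stdAddChar t : ℂ).re ≤ 1 :=
    (Complex.re_le_norm _).trans (AddChar.norm_apply _ _).le
  simpa using blockSpectrum_le_sq_inv (x := x) (c := 1) (t := t) one_pos (by linarith)

theorem blockSpectrum_le_quarter {N : ℕ} [NeZero N] (x : ZMod N) {t : ZMod N}
    (h1 : N ≤ 4 * t.val) (h2 : 4 * t.val ≤ 3 * N) : blockSpectrum N x t ≤ 1 / 4 := by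
  have hN : (0 : ℝ) < N := Nat.cast_pos.mpr (NeZero.pos N)
  have hre : (ZMod.stdAddChar t : ℂ).re ≤ 0 := by
    rw [ZMod.stdAddChar_apply, ZMod.toCircle_eq_circleExp, Circle.coe_exp,
      Complex.exp_ofReal_mul_I_re]
    have h1' : (1 / 4 : ℝ) ≤ t.val / N := by
      rw [le_div_iff₀ hN]
      have : (N : ℝ) ≤ 4 * t.val := by exact_mod_cast h1
      linarith
    have h2' : (t.val / N : ℝ) ≤ 3 / 4 := by
      rw [div_le_iff₀ hN]
      have : (4 * t.val : ℝ) ≤ 3 * N := by exact_mod_cast h2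
      linarith
    apply Real.cos_nonpos_of_pi_div_two_le_of_le <;> nlinarith [Real.pi_pos]
  refine (blockSpectrum_le_sq_inv (c := 2) two_pos (by linarith)).trans ?_
  norm_num

/-- The Fourier transform of `nu N x s`, evaluated at the frequency `t`. -/
theorem sum_nu_mul_stdAddChar (N : ℕ) [NeZero N] (x : ZMod N) (s : ℕ) (t : ZMod N) :
    ∑ j : ZMod N, (nu N x s j : ℂ) * ZMod.stdAddChar (t * j)
      = ∏ i ∈ range s,
        (3 - ZMod.stdAddChar (2 ^ i * t) - ZMod.stdAddChar (2 ^ i * t * x) : ℂ)⁻¹ := by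
  rw [← Finset.prod_range_reflect, ← Fin.prod_univ_eq_prod_range
    (fun i => (3 - ZMod.stdAddChar (2 ^ (s - 1 - i) * t)
      - ZMod.stdAddChar (2 ^ (s - 1 - i) * t * x) : ℂ)⁻¹) s]
  simp_rw [← sum_blockPMF_mul_stdAddChar]
  rw [Finset.prod_univ_sum, Fintype.piFinset_univ]
  simp only [nu, Complex.ofReal_sum, Finset.sum_mul]
  rw [Finset.sum_comm]
  refine Finset.sum_congr rfl fun b _ => ?_
  rw [Finset.sum_eq_single (∑ i : Fin s, (2 : ZMod N) ^ (s - 1 - (i : ℕ)) * b i)]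
  · rw [Finset.prod_mul_distrib, if_pos rfl, mul_one, Complex.ofReal_prod, Finset.mul_sum,
      AddChar.map_finset_sum_eq_prod]
    congr 1
    refine Finset.prod_congr rfl fun i _ => ?_
    congr 1
    ring
  · intro j _ hj
    simp [Ne.symm hj]
  · simp

/-- Parseval's identity on `ZMod N` for real functions. -/
theorem sum_norm_sq_fourier (N : ℕ) [NeZero N] (f : ZMod N → ℝ) :
    ∑ t : ZMod N, ‖∑ j : ZMod N, (f j : ℂ) * ZMod.stdAddChar (t * j)‖ ^ 2
      = N * ∑ j : ZMod N, f j ^ 2 := by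
  have key : ∀ t : ZMod N, ((‖∑ j : ZMod N, (f j : ℂ) * ZMod.stdAddChar (t * j)‖ ^ 2 : ℝ) : ℂ)
      = ∑ j : ZMod N, ∑ k : ZMod N, (f j * f k : ℂ) * ZMod.stdAddChar (t * (j - k)) := by
    intro t
    rw [Complex.ofReal_pow, ← Complex.mul_conj', map_sum, Finset.sum_mul_sum]
    refine Finset.sum_congr rfl fun j _ => Finset.sum_congr rfl fun k _ => ?_
    rw [map_mul (starRingEnd ℂ), Complex.conj_ofReal, ← AddChar.map_neg_eq_conj, mul_sub, sub_eq_add_neg,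
      AddChar.map_add_eq_mul]
    ring
  have : ((∑ t : ZMod N, ‖∑ j : ZMod N, (f j : ℂ) * ZMod.stdAddChar (t * j)‖ ^ 2 : ℝ) : ℂ)
      = ((N * ∑ j : ZMod N, f j ^ 2 : ℝ) : ℂ) := by
    rw [Complex.ofReal_sum]
    simp_rw [key]
    rw [Finset.sum_comm]
    push_cast
    rw [Finset.mul_sum]
    refine Finset.sum_congr rfl fun j _ => ?_
    rw [Finset.sum_comm]
    simp_rw [← Finset.mul_sum, AddChar.sum_mulShift _ (ZMod.isPrimitive_stdAddChar N)]
    rw [Finset.sum_eq_single j]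
    · simp [ZMod.card]
      ring
    · intro k _ hk
      simp [sub_eq_zero, Ne.symm hk]
    · simp
  exact_mod_cast this

theorem chi_square_eq_sum_prod_blockSpectrum (N : ℕ) [NeZero N] (x : ZMod N) (s : ℕ) :
    (N : ℝ) * ∑ j : ZMod N, (nu N x s j - 1 / N) ^ 2
      = ∑ t ∈ univ.erase (0 : ZMod N), ∏ i ∈ range s, blockSpectrum N x (2 ^ i * t) := by
  have hN : (N : ℝ) ≠ 0 := Nat.cast_ne_zero.mpr (NeZero.ne N)
  have hone : ∑ j : ZMod N, nu N x s j = 1 := by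
    have h := sum_nu_mul_stdAddChar N x s 0
    simp only [zero_mul, mul_zero, AddChar.map_zero_eq_one, mul_one] at h
    norm_num at h
    exact_mod_cast h
  have hpar := sum_norm_sq_fourier N (nu N x s)
  have hprod : ∀ t : ZMod N, ‖∑ j : ZMod N, (nu N x s j : ℂ) * ZMod.stdAddChar (t * j)‖ ^ 2
      = ∏ i ∈ range s, blockSpectrum N x (2 ^ i * t) := by
    intro t
    rw [sum_nu_mul_stdAddChar, norm_prod, ← Finset.prod_pow]
    rfl
  simp_rw [hprod] at hpar
  have hzero : ∏ i ∈ range s, blockSpectrum N x (2 ^ i * 0) = 1 :=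
    Finset.prod_eq_one fun i _ => by norm_num [blockSpectrum]
  rw [← Finset.add_sum_erase _ _ (Finset.mem_univ (0 : ZMod N)), hzero] at hpar
  have hexpand : ∑ j : ZMod N, (nu N x s j - 1 / N) ^ 2
      = ∑ j : ZMod N, nu N x s j ^ 2 - 1 / N := by
    simp_rw [sub_sq]
    rw [Finset.sum_add_distrib, Finset.sum_sub_distrib, ← Finset.sum_mul, ← Finset.mul_sum, hone]
    simp [ZMod.card]
    field_simp
    ring
  rw [hexpand, mul_sub, ← hpar]
  field_simp
  ring

/-- The weight `y ^ c`, where `c` counts the positions `i < k` at which the binary digits `i` and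
`i + 1` of `n` differ. -/
noncomputable def altWeight (y : ℝ) (k n : ℕ) : ℝ :=
  ∏ i ∈ range k, if n.testBit i = n.testBit (i + 1) then 1 else y

theorem altWeight_nonneg {y : ℝ} (hy : 0 ≤ y) (k n : ℕ) : 0 ≤ altWeight y k n :=
  Finset.prod_nonneg fun i _ => by split_ifs <;> simp [hy]

theorem sum_altWeight (y : ℝ) (k : ℕ) :
    ∑ n ∈ range (2 ^ (k + 1)), altWeight y k n = 2 * (1 + y) ^ k := by
  have hdouble : ∀ (g : ℕ → ℝ) (M : ℕ),
      ∑ n ∈ range (2 * M), g n = ∑ n ∈ range M, (g (2 * n) + g (2 * n + 1)) := by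
    intro g M
    induction M with
    | zero => simp
    | succ M ih =>
      rw [Nat.mul_succ, Finset.sum_range_succ, Finset.sum_range_succ, ih, Finset.sum_range_succ,
        add_assoc]
  induction k with
  | zero => simp [altWeight]
  | succ k ih =>
    rw [pow_succ' 2 (k + 1), hdouble, pow_succ (1 + y), ← mul_assoc, ← ih, Finset.sum_mul]
    refine Finset.sum_congr rfl fun n _ => ?_
    have h0 : 2 * n / 2 = n := by omega
    have h1 : (2 * n + 1) / 2 = n := by omega
    have h2 : (2 * n) % 2 = 0 := by omega
    have h3 : (2 * n + 1) % 2 = 1 := by omega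
    simp only [altWeight, Finset.prod_range_succ' _ k, Nat.testBit_add_one (2 * n),
      Nat.testBit_add_one (2 * n + 1), h0, h1, Nat.testBit_zero, h2, h3]
    rcases Nat.mod_two_eq_zero_or_one n with h | h <;> simp [h] <;> ring

theorem sum_altWeight_erase_constant (y : ℝ) (k : ℕ) :
    ∑ n ∈ ((range (2 ^ (k + 1))).erase 0).erase (2 ^ (k + 1) - 1), altWeight y k n
      = 2 * ((1 + y) ^ k - 1) := by
  have hpow : 2 ≤ 2 ^ (k + 1) := by
    rw [pow_succ]; have := Nat.one_le_two_pow (n := k); omega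
  have h0 : altWeight y k 0 = 1 := by simp [altWeight]
  have h1 : altWeight y k (2 ^ (k + 1) - 1) = 1 := by
    refine Finset.prod_eq_one fun i hi => ?_
    have := Finset.mem_range.mp hi
    rw [Nat.testBit_two_pow_sub_one, Nat.testBit_two_pow_sub_one, if_pos]
    simp
    omega
  have hsum := sum_altWeight y k
  rw [← Finset.add_sum_erase _ _ (Finset.mem_range.mpr (by omega : 0 < 2 ^ (k + 1))),
    ← Finset.add_sum_erase _ _ (Finset.mem_erase.mpr ⟨by omega, Finset.mem_range.mpr (by omega)⟩ :
      2 ^ (k + 1) - 1 ∈ (range (2 ^ (k + 1))).erase 0), h0, h1] at hsum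
  linarith

/-- If two consecutive binary digits of `v / N` differ, then the corresponding shift of `v / N`
has fractional part between `1/4` and `3/4`. -/
theorem quarter_le_of_div_mod_two_ne {N v : ℕ} (hN : 0 < N)
    (h : 4 * v / N % 2 ≠ 2 * v / N % 2) : N ≤ 4 * (v % N) ∧ 4 * (v % N) ≤ 3 * N := by
  have hv := Nat.div_add_mod v N
  have hr := Nat.mod_lt v hN
  set q := v / N
  set r := v % N
  have e4 : 4 * v / N = 4 * q + 4 * r / N := by
    rw [← hv, show 4 * (N * q + r) = 4 * r + N * (4 * q) by ring, Nat.add_mul_div_left _ _ hN]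
    ring
  have e2 : 2 * v / N = 2 * q + 2 * r / N := by
    rw [← hv, show 2 * (N * q + r) = 2 * r + N * (2 * q) by ring, Nat.add_mul_div_left _ _ hN]
    ring
  rw [e4, e2] at h
  by_contra hcon
  rw [not_and_or] at hcon
  rcases hcon with hc | hc
  · rw [Nat.div_eq_of_lt (by omega : 4 * r < N), Nat.div_eq_of_lt (by omega : 2 * r < N)] at h
    omega
  · rw [Nat.div_eq_of_lt_le (by omega : 3 * N ≤ 4 * r) (by omega),
      Nat.div_eq_of_lt_le (by omega : 1 * N ≤ 2 * r) (by omega)] at h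
    omega

theorem blockSpectrum_le_of_testBit_ne {N : ℕ} [NeZero N] (x t : ZMod N) {i e : ℕ}
    (h : (2 ^ (i + e + 2) * t.val / N).testBit i ≠ (2 ^ (i + e + 2) * t.val / N).testBit (i + 1)) :
    blockSpectrum N x (2 ^ e * t) ≤ 1 / 4 := by
  have hN := NeZero.pos N
  have hval : (2 ^ e * t).val = 2 ^ e * t.val % N := by
    have : (2 ^ e * t : ZMod N) = ((2 ^ e * t.val : ℕ) : ZMod N) := by
      push_cast
      rw [ZMod.natCast_zmod_val]
    rw [this, ZMod.val_natCast]
  have hi : 2 ^ (i + e + 2) * t.val / N / 2 ^ i = 4 * (2 ^ e * t.val) / N := by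
    rw [Nat.div_div_eq_div_mul, mul_comm N,
      show 2 ^ (i + e + 2) * t.val = 2 ^ i * (4 * (2 ^ e * t.val)) by ring,
      Nat.mul_div_mul_left _ _ (by positivity)]
  have hi1 : 2 ^ (i + e + 2) * t.val / N / 2 ^ (i + 1) = 2 * (2 ^ e * t.val) / N := by
    rw [Nat.div_div_eq_div_mul, mul_comm N,
      show 2 ^ (i + e + 2) * t.val = 2 ^ (i + 1) * (2 * (2 ^ e * t.val)) by ring,
      Nat.mul_div_mul_left _ _ (by positivity)]
  rw [Nat.testBit_eq_decide_div_mod_eq, Nat.testBit_eq_decide_div_mod_eq, hi, hi1] at h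
  obtain ⟨h1, h2⟩ := quarter_le_of_div_mod_two_ne hN (fun heq => h (by rw [heq]))
  rw [← hval] at h1 h2
  exact blockSpectrum_le_quarter x h1 h2

theorem prod_blockSpectrum_pow_le_altWeight {N : ℕ} [NeZero N] (x t : ZMod N) {c : ℝ}
    (hc : 1 / 4 ≤ c) (k q : ℕ) :
    (∏ i ∈ range k, blockSpectrum N x (2 ^ i * t)) ^ q
      ≤ altWeight (c ^ q) k (2 ^ (k + 1) * t.val / N) := by
  rw [← Finset.prod_range_reflect, ← Finset.prod_pow, altWeight]
  refine Finset.prod_le_prod (fun i _ => pow_nonneg (blockSpectrum_nonneg _ _ _) _) fun i hi => ?_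
  have hik := Finset.mem_range.mp hi
  split_ifs with h
  · exact pow_le_one₀ (blockSpectrum_nonneg _ _ _) (blockSpectrum_le_one _ _ _)
  · refine pow_le_pow_left₀ (blockSpectrum_nonneg _ _ _) (le_trans ?_ hc) _
    apply blockSpectrum_le_of_testBit_ne (i := i)
    rwa [show i + (k - 1 - i) + 2 = k + 1 by omega]

theorem sum_prod_blockSpectrum_pow_le {N : ℕ} [NeZero N] (x : ZMod N) {c : ℝ} (hc : 1 / 4 ≤ c)
    {k : ℕ} (hk : N < 2 ^ (k + 1)) (q : ℕ) :
    ∑ t ∈ univ.erase (0 : ZMod N), (∏ i ∈ range k, blockSpectrum N x (2 ^ i * t)) ^ q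
      ≤ 2 * ((1 + c ^ q) ^ k - 1) := by
  have hN := NeZero.pos N
  have hcq : 0 ≤ c ^ q := pow_nonneg (by linarith) q
  rw [← sum_altWeight_erase_constant]
  set P := 2 ^ (k + 1) with hP
  have hlt : ∀ a b : ℕ, a < b → P * a / N < P * b / N := by
    intro a b hab
    have h1 : P * a / N + 1 = (P * a + N) / N := (Nat.add_div_right _ hN).symm
    have h2 : (P * a + N) / N ≤ P * b / N := Nat.div_le_div_right (by nlinarith)
    omega
  have hinj : Function.Injective fun t : ZMod N => P * t.val / N := by
    intro t u htu
    apply ZMod.val_injective N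
    rcases lt_trichotomy t.val u.val with h | h | h
    · exact absurd htu (hlt _ _ h).ne
    · exact h
    · exact absurd htu (hlt _ _ h).ne'
  calc ∑ t ∈ univ.erase (0 : ZMod N), (∏ i ∈ range k, blockSpectrum N x (2 ^ i * t)) ^ q
      ≤ ∑ t ∈ univ.erase (0 : ZMod N), altWeight (c ^ q) k (P * t.val / N) :=
        Finset.sum_le_sum fun t _ => prod_blockSpectrum_pow_le_altWeight x t hc k q
    _ = ∑ n ∈ (univ.erase (0 : ZMod N)).image fun t => P * t.val / N, altWeight (c ^ q) k n :=
        (Finset.sum_image fun a _ b _ h => hinj h).symm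
    _ ≤ _ := by
        refine Finset.sum_le_sum_of_subset_of_nonneg ?_ fun n _ _ => altWeight_nonneg hcq k n
        intro n hn
        obtain ⟨t, ht, rfl⟩ := Finset.mem_image.mp hn
        have ht0 : 0 < t.val :=
          Nat.pos_of_ne_zero ((ZMod.val_ne_zero t).mpr (Finset.ne_of_mem_erase ht))
        have hpos : 0 < P * t.val / N := Nat.div_pos (by nlinarith) hN
        have htop : P * t.val / N < P - 1 := by
          rw [Nat.div_lt_iff_lt_mul hN]
          obtain ⟨p, hp⟩ : ∃ p, P = p + 1 := ⟨P - 1, by omega⟩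
          have := ZMod.val_lt t
          rw [hp] at hk ⊢
          simp only [Nat.add_sub_cancel]
          nlinarith
        simp only [Finset.mem_erase, Finset.mem_range]
        omega

theorem prod_range_mul_eq_prod_prod {M : Type*} [CommMonoid M] (f : ℕ → M) (m q : ℕ) :
    ∏ i ∈ range (m * q), f i = ∏ j ∈ range q, ∏ i ∈ range m, f (m * j + i) := by
  induction q with
  | zero => simp
  | succ q ih => rw [Nat.mul_succ, Finset.prod_range_add, ih, Finset.prod_range_succ]

theorem prod_le_sum_pow_div {q : ℕ} (hq : q ≠ 0) (z : ℕ → ℝ) (hz : ∀ j, 0 ≤ z j) :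
    ∏ j ∈ range q, z j ≤ ∑ j ∈ range q, (q : ℝ)⁻¹ * z j ^ q := by
  have hq' : (q : ℝ) ≠ 0 := Nat.cast_ne_zero.mpr hq
  have h := Real.geom_mean_le_arith_mean_weighted (range q) (fun _ => (q : ℝ)⁻¹)
    (fun j => z j ^ q) (fun _ _ => by positivity) (by simp [hq']) (fun j _ => pow_nonneg (hz j) q)
  refine le_trans (le_of_eq (Finset.prod_congr rfl fun j _ => ?_)) h
  exact (Real.pow_rpow_inv_natCast (hz j) hq).symm

/-- Sums over nonzero residues of products along orbits are controlled by powers of a single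
block. -/
theorem sum_prod_orbit_le_sum_pow {R : Type*} [CommRing R] [Fintype R] [DecidableEq R]
    {u : R} (hu : IsUnit u) (F : R → ℝ) (hF : ∀ t, 0 ≤ F t) (q : ℕ) :
    ∑ t ∈ univ.erase (0 : R), ∏ j ∈ range q, F (u ^ j * t)
      ≤ ∑ t ∈ univ.erase (0 : R), F t ^ q := by
  rcases eq_or_ne q 0 with rfl | hq
  · simp
  have hq' : (q : ℝ) ≠ 0 := Nat.cast_ne_zero.mpr hq
  have hshift : ∀ j, ∑ t ∈ univ.erase (0 : R), F (u ^ j * t) ^ q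
      = ∑ t ∈ univ.erase (0 : R), F t ^ q := by
    intro j
    obtain ⟨w, hw⟩ := hu.pow j
    rw [← hw]
    refine Finset.sum_equiv (Units.mulLeft w) (fun t => ?_) fun t _ => rfl
    simp
  calc ∑ t ∈ univ.erase (0 : R), ∏ j ∈ range q, F (u ^ j * t)
      ≤ ∑ t ∈ univ.erase (0 : R), ∑ j ∈ range q, (q : ℝ)⁻¹ * F (u ^ j * t) ^ q :=
        Finset.sum_le_sum fun t _ => prod_le_sum_pow_div hq _ fun j => hF _
    _ = ∑ t ∈ univ.erase (0 : R), F t ^ q := by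
        rw [Finset.sum_comm]
        simp_rw [← Finset.mul_sum, hshift]
        rw [Finset.sum_const, Finset.card_range, nsmul_eq_mul, inv_mul_cancel_left₀ hq']

theorem chi_square_bound_block_walk (N : ℕ) [NeZero N] (hN : 3 ≤ N) (hodd : Odd N)
    (x : ZMod N) (m : ℕ) (hm1 : 2 ^ (m - 1) < N) (hm2 : N < 2 ^ m)
    (s : ℕ) (hs : 1 ≤ s) :
    (N : ℝ) * ∑ j : ZMod N, (nu N x s j - 1 / N) ^ 2
      ≤ 2 * ((1 + (1 - (4 - Real.sqrt 10) / 9) ^ (2 * (s / m))) ^ (m - 1) - 1) := by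
  obtain ⟨k, rfl⟩ : ∃ k, m = k + 1 :=
    ⟨m - 1, by rcases m with _ | m <;> [(norm_num at hm2; omega); simp]⟩
  rw [chi_square_eq_sum_prod_blockSpectrum, Nat.add_sub_cancel, pow_mul]
  set q := s / (k + 1) with hq
  have hc : (1 / 4 : ℝ) ≤ (1 - (4 - Real.sqrt 10) / 9) ^ 2 := by
    have := Real.sqrt_nonneg 10
    nlinarith
  refine le_trans ?_ (sum_prod_blockSpectrum_pow_le x hc hm2 q)
  have hunit : IsUnit ((2 : ZMod N) ^ (k + 1)) := by
    refine IsUnit.pow _ ?_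
    have : IsUnit ((2 : ℕ) : ZMod N) :=
      (ZMod.isUnit_iff_coprime 2 N).mpr (Nat.coprime_two_left.mpr hodd)
    exact_mod_cast this
  have h0 := blockSpectrum_nonneg N x
  have h1 := blockSpectrum_le_one N x
  refine le_trans (Finset.sum_le_sum fun t _ => ?_) (sum_prod_orbit_le_sum_pow hunit
    (fun t => ∏ i ∈ range k, blockSpectrum N x (2 ^ i * t))
    (fun t => Finset.prod_nonneg fun i _ => h0 _) q)
  calc ∏ i ∈ range s, blockSpectrum N x (2 ^ i * t)
      ≤ ∏ i ∈ range ((k + 1) * q), blockSpectrum N x (2 ^ i * t) :=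
        Finset.prod_le_prod_of_subset_of_le_one
          (Finset.range_subset_range.mpr (Nat.mul_div_le s (k + 1)))
          (fun i _ => h0 _) (fun i _ _ => h1 _)
    _ = ∏ j ∈ range q, ∏ i ∈ range (k + 1), blockSpectrum N x (2 ^ ((k + 1) * j + i) * t) :=
        prod_range_mul_eq_prod_prod _ _ _
    _ ≤ ∏ j ∈ range q, ∏ i ∈ range k, blockSpectrum N x (2 ^ i * ((2 ^ (k + 1)) ^ j * t)) := by
        refine Finset.prod_le_prod (fun j _ => Finset.prod_nonneg fun i _ => h0 _) fun j _ => ?_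
        rw [Finset.prod_range_succ]
        refine (mul_le_of_le_one_right (Finset.prod_nonneg fun i _ => h0 _) (h1 _)).trans
          (le_of_eq (Finset.prod_congr rfl fun i _ => ?_))
        congr 1
        rw [← pow_mul, pow_add]
        ring
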